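/- For every integer n ≥ d, the number Λ_n := Σ_{(j,k)∈I₊} λ_{j,k} S_n^{(k)}(c_j) P_n^{(k)}(c_j) is strictly positive. -/

import Mathlib

open Polynomial MeasureTheory Finset

noncomputable section

/-- The `k`-th derivative of a real polynomial. -/
def iterDeriv (k : ℕ) (f : Polynomial ℝ) : Polynomial ℝ := Polynomial.derivative^[k] f

/-- The Jacobi measure `dμ^{α,β}(x) = (1-x)^α (1+x)^β dx` on `[-1,1]`. -/
def jacobiMeasure (α β : ℝ) : Measure ℝ :=
  (volume.restrict (Set.Icc (-1 : ℝ) 1)).withDensity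
    fun x => ENNReal.ofReal ((1 - x) ^ α * (1 + x) ^ β)

/-- The Jacobi–Sobolev inner product
`⟨f,g⟩_S = ∫ f g dμ^{α,β} + ∑_{j=1}^N ∑_{k=0}^{d_j} λ_{j,k} f^{(k)}(c_j) g^{(k)}(c_j)`. -/
def sobolevIP (α β : ℝ) {N : ℕ} (c : Fin N → ℝ) (dd : Fin N → ℕ)
    (lam : Fin N → ℕ → ℝ) (f g : Polynomial ℝ) : ℝ :=
  (∫ x, f.eval x * g.eval x ∂(jacobiMeasure α β)) +
    ∑ j : Fin N, ∑ k ∈ Finset.range (dd j + 1),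
      lam j k * (iterDeriv k f).eval (c j) * (iterDeriv k g).eval (c j)

/-- The degree-`k` Taylor polynomial of `f` centred at `c`:
`Q_k(x,c;f) = ∑_{ν=0}^k f^{(ν)}(c)(x-c)^ν/ν!` (as a polynomial in `x`). -/
def taylorPoly (k : ℕ) (c : ℝ) (f : Polynomial ℝ) : Polynomial ℝ :=
  ∑ ν ∈ Finset.range (k + 1),
    Polynomial.C ((iterDeriv ν f).eval c / Nat.factorial ν) * (X - Polynomial.C c) ^ ν

/-- `ρ(x) = ∏_{j=1}^N (x-c_j)^{d_j+1}`. -/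
def rhoPoly {N : ℕ} (c : Fin N → ℝ) (dd : Fin N → ℕ) : Polynomial ℝ :=
  ∏ j : Fin N, (X - Polynomial.C (c j)) ^ (dd j + 1)

/-- `ρ_{j,k}(x) = ρ(x)/(x-c_j)^{k+1} = (x-c_j)^{d_j-k} ∏_{i≠j} (x-c_i)^{d_i+1}`. -/
def rhoJK {N : ℕ} (c : Fin N → ℝ) (dd : Fin N → ℕ) (j : Fin N) (k : ℕ) : Polynomial ℝ :=
  (X - Polynomial.C (c j)) ^ (dd j - k) *
    ∏ i ∈ Finset.univ.erase j, (X - Polynomial.C (c i)) ^ (dd i + 1)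

/-- `â_n(x) = -n((2n+α+β)x+β-α)/(2n+α+β)`. -/
def ahat (α β : ℝ) (n : ℕ) : Polynomial ℝ :=
  Polynomial.C (-(n : ℝ) / (2 * (n : ℝ) + α + β)) *
    (Polynomial.C (2 * (n : ℝ) + α + β) * X + Polynomial.C (β - α))

/-- `b̂_n = 4n(n+α)(n+β)(n+α+β)/((2n+α+β)²(2n+α+β-1))`. -/
def bhat (α β : ℝ) (n : ℕ) : ℝ :=
  4 * (n : ℝ) * ((n : ℝ) + α) * ((n : ℝ) + β) * ((n : ℝ) + α + β) /
    ((2 * (n : ℝ) + α + β) ^ 2 * (2 * (n : ℝ) + α + β - 1))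

/-- `ĉ_n(x) = (n+α+β)((2n+α+β)x+α-β)/(2n+α+β)`. -/
def chat (α β : ℝ) (n : ℕ) : Polynomial ℝ :=
  Polynomial.C (((n : ℝ) + α + β) / (2 * (n : ℝ) + α + β)) *
    (Polynomial.C (2 * (n : ℝ) + α + β) * X + Polynomial.C (α - β))

/-- `d̂_n = -(2n+α+β-1)`. -/
def dhat (α β : ℝ) (n : ℕ) : ℝ := -(2 * (n : ℝ) + α + β - 1)

/-- `γ_{1,n} = (β²-α²)/((2n+α+β)(2n+α+β+2))`. -/
def gamma1 (α β : ℝ) (n : ℕ) : ℝ :=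
  (β ^ 2 - α ^ 2) / ((2 * (n : ℝ) + α + β) * (2 * (n : ℝ) + α + β + 2))

/-- `γ_{2,n} = 4n(n+α)(n+β)(n+α+β)/((2n+α+β)²((2n+α+β)²-1))`. -/
def gamma2 (α β : ℝ) (n : ℕ) : ℝ :=
  4 * (n : ℝ) * ((n : ℝ) + α) * ((n : ℝ) + β) * ((n : ℝ) + α + β) /
    ((2 * (n : ℝ) + α + β) ^ 2 * ((2 * (n : ℝ) + α + β) ^ 2 - 1))

theorem integrableOn_jacobiWeight {α β : ℝ} (hα : -1 < α) (hβ : -1 < β) :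
    IntegrableOn (fun x : ℝ => (1 - x) ^ α * (1 + x) ^ β) (Set.Icc (-1) 1) := by
  have hl : IntervalIntegrable (fun x : ℝ => (1 - x) ^ α * (1 + x) ^ β) volume (-1) 0 := by
    have h := (intervalIntegral.intervalIntegrable_rpow' (a := 0) (b := 1) hβ).comp_add_left 1
    norm_num at h
    refine h.continuousOn_mul (ContinuousOn.rpow_const (by fun_prop) fun x hx => Or.inl ?_)
    rw [Set.uIcc_of_le (by norm_num)] at hx
    linarith [hx.2]
  have hr : IntervalIntegrable (fun x : ℝ => (1 - x) ^ α * (1 + x) ^ β) volume 0 1 := by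
    have h := (intervalIntegral.intervalIntegrable_rpow' (a := 1) (b := 0) hα).comp_sub_left 1
    norm_num at h
    refine h.mul_continuousOn (ContinuousOn.rpow_const (by fun_prop) fun x hx => Or.inl ?_)
    rw [Set.uIcc_of_le (by norm_num)] at hx
    linarith [hx.1]
  exact (intervalIntegrable_iff_integrableOn_Icc_of_le (by norm_num)).1 (hl.trans hr)

theorem isFiniteMeasure_jacobiMeasure {α β : ℝ} (hα : -1 < α) (hβ : -1 < β) :
    IsFiniteMeasure (jacobiMeasure α β) :=
  isFiniteMeasure_withDensity_ofReal (integrableOn_jacobiWeight hα hβ).2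

theorem ae_jacobiMeasure_mem_Ioo (α β : ℝ) :
    ∀ᵐ x ∂(jacobiMeasure α β), x ∈ Set.Ioo (-1 : ℝ) 1 := by
  refine (withDensity_absolutelyContinuous _ _).ae_le ?_
  rw [← restrict_Ioo_eq_restrict_Icc]
  exact ae_restrict_mem measurableSet_Ioo

theorem integrable_eval_jacobiMeasure {α β : ℝ} (hα : -1 < α) (hβ : -1 < β) (f : ℝ[X]) :
    Integrable (fun x => f.eval x) (jacobiMeasure α β) := by
  have := isFiniteMeasure_jacobiMeasure hα hβ
  obtain ⟨C, hC⟩ := (isCompact_Icc (a := (-1 : ℝ)) (b := 1)).exists_bound_of_continuousOn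
    f.continuous.continuousOn
  refine Integrable.of_bound f.continuous.aestronglyMeasurable C ?_
  filter_upwards [ae_jacobiMeasure_mem_Ioo α β] with x hx
  exact hC x (Set.Ioo_subset_Icc_self hx)

theorem integral_eval_jacobiMeasure_pos {α β : ℝ} (hα : -1 < α) (hβ : -1 < β) {f : ℝ[X]}
    (hf : f ≠ 0) (hnn : ∀ x ∈ Set.Ioo (-1 : ℝ) 1, 0 ≤ f.eval x) :
    0 < ∫ x, f.eval x ∂(jacobiMeasure α β) := by
  have hae : 0 ≤ᵐ[jacobiMeasure α β] fun x => f.eval x := by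
    filter_upwards [ae_jacobiMeasure_mem_Ioo α β] with x hx using hnn x hx
  refine (integral_nonneg_of_ae hae).lt_of_ne' fun h => ?_
  rw [integral_eq_zero_iff_of_nonneg_ae hae (integrable_eval_jacobiMeasure hα hβ f)] at h
  have h' : ∀ᵐ x ∂(jacobiMeasure α β), f.eval x = 0 := h
  rw [jacobiMeasure, ae_withDensity_iff (by fun_prop), ae_restrict_iff' measurableSet_Icc] at h'
  have hroots : ∀ᵐ x : ℝ, ¬ f.IsRoot x := by
    rw [ae_iff]
    simpa using (finite_setOfPred_isRoot hf).measure_zero volume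
  have hIoo : ∀ᵐ x : ℝ, x ∉ Set.Ioo (-1 : ℝ) 1 := by
    filter_upwards [h', hroots] with x hx hx' hmem
    refine hx' (hx (Set.Ioo_subset_Icc_self hmem) ?_)
    have h1 : (0 : ℝ) < 1 - x := by linarith [hmem.2]
    have h2 : (0 : ℝ) < 1 + x := by linarith [hmem.1]
    rw [ne_eq, ENNReal.ofReal_eq_zero, not_le]
    positivity
  have hvol : volume (Set.Ioo (-1 : ℝ) 1) = 0 := measure_eq_zero_iff_ae_notMem.2 hIoo
  norm_num at hvol

/-- A linear functional vanishing on monic polynomials of degrees `0, …, n - 1` vanishes on all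
polynomials of degree less than `n`. -/
theorem linearMap_eq_zero_of_degree_lt (L : ℝ[X] →ₗ[ℝ] ℝ) (B : ℕ → ℝ[X])
    (hBm : ∀ m, (B m).Monic) (hBd : ∀ m, (B m).natDegree = m) (n : ℕ)
    (hL : ∀ l < n, L (B l) = 0) (Q : ℝ[X]) (hQ : Q.degree < n) : L Q = 0 := by
  induction n generalizing Q with
  | zero =>
    have : Q = 0 := by simpa [Polynomial.degree_eq_bot, Nat.WithBot.lt_zero_iff] using hQ
    simp [this]
  | succ n ih =>
    have h := ih (fun l hl => hL l (by omega)) (Q - Q.coeff n • B n) <| by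
      rw [degree_lt_iff_coeff_zero]
      intro m hm
      rcases hm.eq_or_lt with rfl | hm
      · have : (B n).coeff n = 1 := by simpa [hBd] using (hBm n).coeff_natDegree
        simp [this]
      · rw [coeff_sub, coeff_smul, (degree_lt_iff_coeff_zero Q (n + 1)).1 hQ m hm,
          coeff_eq_zero_of_natDegree_lt ((hBd n).trans_lt hm)]
        simp
    simpa [hL n (by omega)] using h

theorem exists_isRoot_mem_Ioo_of_dvd_orthogonal {α β : ℝ} (hα : -1 < α) (hβ : -1 < β) {p g : ℝ[X]}
    (hp : p ≠ 0)
    (horth : ∀ Q : ℝ[X], Q.degree < p.natDegree →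
      ∫ x, p.eval x * Q.eval x ∂(jacobiMeasure α β) = 0)
    (hg : 0 < g.natDegree) (hgp : g ∣ p) : ∃ x ∈ Set.Ioo (-1 : ℝ) 1, g.IsRoot x := by
  by_contra! hroot
  obtain ⟨q, rfl⟩ := hgp
  have hg0 : g ≠ 0 := left_ne_zero_of_mul hp
  have hq0 : q ≠ 0 := right_ne_zero_of_mul hp
  have h := horth q <| by
    rw [degree_eq_natDegree hq0, natDegree_mul hg0 hq0]
    exact_mod_cast by omega
  have hsign : (∀ x ∈ Set.Ioo (-1 : ℝ) 1, 0 ≤ g.eval x) ∨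
      ∀ x ∈ Set.Ioo (-1 : ℝ) 1, 0 ≤ (-g).eval x := by
    by_contra! hcon
    obtain ⟨⟨x, hx, hx0⟩, y, hy, hy0⟩ := hcon
    obtain ⟨z, hz, hz0⟩ := isPreconnected_Ioo.intermediate_value hx hy
      g.continuous.continuousOn ⟨hx0.le, by simpa using hy0.le⟩
    exact hroot z hz hz0
  rcases hsign with hs | hs
  · refine (integral_eval_jacobiMeasure_pos hα hβ (f := g * q * q)
      (mul_ne_zero hp hq0) fun x hx => ?_).ne' (by simpa using h)
    have := mul_nonneg (hs x hx) (mul_self_nonneg (q.eval x))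
    simpa [mul_assoc] using this
  · refine (integral_eval_jacobiMeasure_pos hα hβ (f := -g * q * q)
      (mul_ne_zero (mul_ne_zero (neg_ne_zero.2 hg0) hq0) hq0) fun x hx => ?_).ne' ?_
    · have := mul_nonneg (hs x hx) (mul_self_nonneg (q.eval x))
      simpa [mul_assoc] using this
    · simpa [integral_neg] using h

theorem splits_of_orthogonal {α β : ℝ} (hα : -1 < α) (hβ : -1 < β) {p : ℝ[X]} (hp : p ≠ 0)
    (horth : ∀ Q : ℝ[X], Q.degree < p.natDegree →
      ∫ x, p.eval x * Q.eval x ∂(jacobiMeasure α β) = 0) :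
    p.Splits := by
  obtain ⟨u, hu⟩ := UniqueFactorizationMonoid.factors_prod hp
  rw [← hu]
  refine (Splits.multisetProd fun g hg => ?_).mul u.isUnit.splits
  have hirr := UniqueFactorizationMonoid.irreducible_of_factor g hg
  obtain ⟨x, -, hx⟩ := exists_isRoot_mem_Ioo_of_dvd_orthogonal hα hβ hp horth hirr.natDegree_pos
    (UniqueFactorizationMonoid.dvd_of_mem_factors hg)
  exact Splits.of_degree_eq_one (degree_eq_one_of_irreducible_of_root hirr hx)

theorem roots_mem_Ioo_of_orthogonal {α β : ℝ} (hα : -1 < α) (hβ : -1 < β) {p : ℝ[X]}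
    (hp : p ≠ 0)
    (horth : ∀ Q : ℝ[X], Q.degree < p.natDegree →
      ∫ x, p.eval x * Q.eval x ∂(jacobiMeasure α β) = 0) {r : ℝ} (hr : r ∈ p.roots) :
    r ∈ Set.Ioo (-1 : ℝ) 1 := by
  obtain ⟨x, hx, hx0⟩ := exists_isRoot_mem_Ioo_of_dvd_orthogonal hα hβ hp horth
    (g := X - C r) (by simp) (dvd_iff_isRoot.2 (isRoot_of_mem_roots hr))
  rwa [← root_X_sub_C.1 hx0] at hx

theorem iterDeriv_eval (k : ℕ) (f : ℝ[X]) (c : ℝ) :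
    (iterDeriv k f).eval c = k.factorial * (taylor c f).coeff k := by
  rw [taylor_coeff, iterDeriv, ← factorial_smul_hasseDeriv]
  simp

theorem taylor_prod_coeff_sign {s c : ℝ} (hs : s * s = 1) (m : Multiset ℝ)
    (hm : ∀ r ∈ m, 0 < s * (c - r)) (k : ℕ) :
    0 ≤ s ^ (m.card + k) * (taylor c (m.map fun r => X - C r).prod).coeff k ∧
      (k ≤ m.card → 0 < s ^ (m.card + k) * (taylor c (m.map fun r => X - C r).prod).coeff k) := by
  induction m using Multiset.induction_on generalizing k with
  | empty =>
    rcases k with _ | k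
    · simp
    · simp [coeff_one]
  | cons r m ih =>
    have hr := hm r (Multiset.mem_cons_self r m)
    have ih := ih fun r' hr' => hm r' (Multiset.mem_cons_of_mem hr')
    have htaylor : taylor c (X - C r) = X + C (c - r) := by
      simp [add_sub_assoc]
    rw [Multiset.map_cons, Multiset.prod_cons, taylor_mul, htaylor, Multiset.card_cons, add_mul]
    set p := taylor c (m.map fun r => X - C r).prod
    rcases k with _ | k
    · have h := mul_pos hr ((ih 0).2 (Nat.zero_le _))
      have e : s ^ (m.card + 1 + 0) * (X * p + C (c - r) * p).coeff 0 =
          s * (c - r) * (s ^ (m.card + 0) * p.coeff 0) := by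
        simp [pow_succ]; ring
      rw [e]
      exact ⟨h.le, fun _ => h⟩
    · have e : s ^ (m.card + 1 + (k + 1)) * (X * p + C (c - r) * p).coeff (k + 1) =
          s ^ (m.card + k) * p.coeff k +
            s * (c - r) * (s ^ (m.card + (k + 1)) * p.coeff (k + 1)) := by
        simp only [coeff_add, coeff_X_mul, coeff_C_mul]
        linear_combination s ^ (m.card + k) * p.coeff k * hs
      have h := mul_nonneg hr.le (ih (k + 1)).1
      rw [e]
      exact ⟨add_nonneg (ih k).1 h,
        fun hk => add_pos_of_pos_of_nonneg ((ih k).2 (by omega)) h⟩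

theorem iterDeriv_eval_ne_zero {p : ℝ[X]} (hp : p.Monic) (hsplit : p.Splits)
    (hroots : ∀ r ∈ p.roots, r ∈ Set.Ioo (-1 : ℝ) 1) {c : ℝ} (hc : c ∉ Set.Ioo (-1 : ℝ) 1)
    {k : ℕ} (hk : k ≤ p.natDegree) : (iterDeriv k p).eval c ≠ 0 := by
  rw [iterDeriv_eval, hsplit.eq_prod_roots_of_monic hp]
  rw [hsplit.natDegree_eq_card_roots] at hk
  obtain ⟨s, hs, hsc⟩ : ∃ s : ℝ, s * s = 1 ∧ ∀ r ∈ p.roots, 0 < s * (c - r) := by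
    rcases le_or_gt 1 c with h | h
    · exact ⟨1, by norm_num, fun r hr => by linarith [(hroots r hr).2]⟩
    · have h' : c ≤ -1 := by
        by_contra! h'
        exact hc ⟨h', h⟩
      exact ⟨-1, by norm_num, fun r hr => by linarith [(hroots r hr).1]⟩
  have h := (taylor_prod_coeff_sign hs p.roots hsc k).2 hk
  exact mul_ne_zero (by positivity) (right_ne_zero_of_mul h.ne')

/-- The functional `Q ↦ ∫ Q f dμ^{α,β}`. -/
def jacobiPairing {α β : ℝ} (hα : -1 < α) (hβ : -1 < β) (f : ℝ[X]) : ℝ[X] →ₗ[ℝ] ℝ where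
  toFun Q := ∫ x, Q.eval x * f.eval x ∂(jacobiMeasure α β)
  map_add' p q := by
    have h (r : ℝ[X]) := integrable_eval_jacobiMeasure hα hβ (r * f)
    simp only [eval_mul] at h
    simp only [eval_add, add_mul]
    exact integral_add (h p) (h q)
  map_smul' a p := by
    simp only [eval_smul, smul_eq_mul, mul_assoc, integral_const_mul, RingHom.id_apply]

/-- The functional `Q ↦ ⟨Q, f⟩_S`. -/
def sobolevPairing {α β : ℝ} (hα : -1 < α) (hβ : -1 < β) {N : ℕ} (c : Fin N → ℝ)
    (dd : Fin N → ℕ) (lam : Fin N → ℕ → ℝ) (f : ℝ[X]) : ℝ[X] →ₗ[ℝ] ℝ where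
  toFun Q := sobolevIP α β c dd lam Q f
  map_add' p q := by
    have h := (jacobiPairing hα hβ f).map_add p q
    simp only [jacobiPairing, LinearMap.coe_mk, AddHom.coe_mk] at h
    simp only [sobolevIP, h, iterDeriv, iterate_map_add, eval_add (p := derivative^[_] _),
      mul_add, add_mul, Finset.sum_add_distrib]
    ring
  map_smul' a p := by
    have h := (jacobiPairing hα hβ f).map_smul a p
    simp only [jacobiPairing, LinearMap.coe_mk, AddHom.coe_mk, smul_eq_mul] at h
    simp only [sobolevIP, h, iterDeriv, RingHom.id_apply, smul_eq_mul, mul_add, Finset.mul_sum]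
    congr 1
    simp only [iterate_derivative_smul, eval_smul, smul_eq_mul]
    exact Finset.sum_congr rfl fun j _ => Finset.sum_congr rfl fun k _ => by ring

theorem stmt7 (α β : ℝ) (hα : -1 < α) (hβ : -1 < β)
    (N : ℕ) (hN : 1 ≤ N)
    (c : Fin N → ℝ) (hc : Function.Injective c) (hcout : ∀ j, c j ∉ Set.Ioo (-1 : ℝ) 1)
    (dd : Fin N → ℕ) (hdd : Monotone dd)
    (lam : Fin N → ℕ → ℝ) (hlam : ∀ j k, 0 ≤ lam j k) (hlamd : ∀ j, 0 < lam j (dd j))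
    (d : ℕ) (hd : d = ∑ j, (dd j + 1))
    (P : ℕ → Polynomial ℝ) (hPm : ∀ m, (P m).Monic) (hPd : ∀ m, (P m).natDegree = m)
    (hPo : ∀ m l, m ≠ l → ∫ x, (P m).eval x * (P l).eval x ∂(jacobiMeasure α β) = 0)
    (S : ℕ → Polynomial ℝ) (hSm : ∀ m, (S m).Monic) (hSd : ∀ m, (S m).natDegree = m)
    (hSo : ∀ m l, l < m → sobolevIP α β c dd lam (X ^ l) (S m) = 0)
    (n : ℕ) (hn : d ≤ n) :
    0 < ∑ j : Fin N, ∑ k ∈ Finset.range (dd j + 1),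
      lam j k * (iterDeriv k (S n)).eval (c j) * (iterDeriv k (P n)).eval (c j) := by
  have hI := integrable_eval_jacobiMeasure hα hβ
  have horth (Q : ℝ[X]) (hQ : Q.degree < n) :
      ∫ x, Q.eval x * (P n).eval x ∂(jacobiMeasure α β) = 0 :=
    linearMap_eq_zero_of_degree_lt (jacobiPairing hα hβ (P n)) P hPm hPd n
      (fun l hl => hPo l n hl.ne) Q hQ
  have horth' (Q : ℝ[X]) (hQ : Q.degree < (P n).natDegree) :
      ∫ x, (P n).eval x * Q.eval x ∂(jacobiMeasure α β) = 0 := by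
    simpa only [mul_comm] using horth Q (by rwa [hPd] at hQ)
  have hdeg : (S n - P n).degree < n := by
    have h := degree_sub_lt_left (p := S n) (q := P n)
      (by rw [degree_eq_natDegree (hSm n).ne_zero, degree_eq_natDegree (hPm n).ne_zero, hSd, hPd])
      (hSm n).ne_zero (by rw [hSm n, hPm n])
    rwa [degree_eq_natDegree (hSm n).ne_zero, hSd] at h
  have hS : sobolevIP α β c dd lam (S n - P n) (S n) = 0 :=
    linearMap_eq_zero_of_degree_lt (sobolevPairing hα hβ c dd lam (S n)) (fun l => X ^ l)
      (fun l => monic_X_pow l) (fun l => natDegree_X_pow l) n (fun l hl => hSo n l hl) _ hdeg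
  have hint : ∫ x, (S n - P n).eval x * (S n).eval x ∂(jacobiMeasure α β) =
      ∫ x, ((S n - P n) * (S n - P n)).eval x ∂(jacobiMeasure α β) := by
    have h1 := hI ((S n - P n) * (S n - P n))
    have h2 := hI ((S n - P n) * P n)
    rw [← add_zero (∫ x, ((S n - P n) * (S n - P n)).eval x ∂(jacobiMeasure α β)),
      ← horth _ hdeg]
    simp only [← eval_mul]
    rw [← integral_add h1 h2]
    simp only [← eval_add]
    congr! 3
    ring
  have key : ∑ j : Fin N, ∑ k ∈ Finset.range (dd j + 1),
      lam j k * (iterDeriv k (S n)).eval (c j) * (iterDeriv k (P n)).eval (c j) =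
      ∫ x, ((S n - P n) * (S n - P n)).eval x ∂(jacobiMeasure α β) +
        ∑ j : Fin N, ∑ k ∈ Finset.range (dd j + 1),
          lam j k * (iterDeriv k (S n)).eval (c j) ^ 2 := by
    rw [sobolevIP, hint] at hS
    rw [← sub_eq_zero, ← neg_eq_zero, ← hS, neg_sub, add_sub_assoc, ← Finset.sum_sub_distrib]
    congr 1
    refine Finset.sum_congr rfl fun j _ => ?_
    rw [← Finset.sum_sub_distrib]
    refine Finset.sum_congr rfl fun k _ => ?_
    simp only [iterDeriv, iterate_derivative_sub, eval_sub]
    ring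
  rw [key]
  have hterm (j : Fin N) (k : ℕ) : 0 ≤ lam j k * (iterDeriv k (S n)).eval (c j) ^ 2 :=
    mul_nonneg (hlam j k) (sq_nonneg _)
  by_cases hSP : S n = P n
  · have j : Fin N := ⟨0, hN⟩
    have hdj : dd j ≤ n := by
      have := Finset.single_le_sum (f := fun j => dd j + 1) (fun i _ => Nat.zero_le _)
        (Finset.mem_univ j)
      omega
    have hne : (iterDeriv (dd j) (S n)).eval (c j) ≠ 0 := by
      rw [hSP]
      exact iterDeriv_eval_ne_zero (hPm n) (splits_of_orthogonal hα hβ (hPm n).ne_zero horth')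
        (fun r hr => roots_mem_Ioo_of_orthogonal hα hβ (hPm n).ne_zero horth' hr) (hcout j)
        (by rwa [hPd])
    refine add_pos_of_nonneg_of_pos (by simp [hSP]) ?_
    refine Finset.sum_pos' (fun i _ => Finset.sum_nonneg fun k _ => hterm i k)
      ⟨j, Finset.mem_univ j, Finset.sum_pos' (fun k _ => hterm j k)
        ⟨dd j, by simp, mul_pos (hlamd j) (by positivity)⟩⟩
  · have h0 := sub_ne_zero.2 hSP
    refine add_pos_of_pos_of_nonneg (integral_eval_jacobiMeasure_pos hα hβ (mul_ne_zero h0 h0)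
      fun x _ => by simpa using mul_self_nonneg _)
      (Finset.sum_nonneg fun i _ => Finset.sum_nonneg fun k _ => hterm i k)
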